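/- Let G be a finite directed graph with edge weights w : E(G) → ℝ that are pairwise distinct, and let s, t be vertices such that at least one directed path from s to t exists. Then every retractable simple directed path π from s to t satisfies b(π) = d_B(s,t); that is, the retractable path realizes the bottleneck distance from s to t. -/

import Mathlib

open Set

variable {V : Type*}

/-- `l` is a directed path (a nonempty list of vertices, consecutive ones joined by edges
of `Adj`) from `s` to `t`. -/
def IsDiPath (Adj : V → V → Prop) (s t : V) (l : List V) : Prop :=
  l.head? = some s ∧ l.getLast? = some t ∧ l.Chain' Adj

/-- The bottleneck of a path: the maximum weight of an edge on it. -/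
noncomputable def bottleneck (w : V → V → ℝ) (l : List V) : ℝ :=
  sSup ((fun e : V × V => w e.1 e.2) '' { e | e ∈ l.zip l.tail })

/-- The bottleneck distance from `s` to `t`: the minimum bottleneck of a simple directed
path from `s` to `t`. -/
noncomputable def dBot (Adj : V → V → Prop) (w : V → V → ℝ) (s t : V) : ℝ :=
  sInf { r | ∃ l, IsDiPath Adj s t l ∧ l.Nodup ∧ r = bottleneck w l }

/-- `e` is the bottleneck edge of `s` and `t`: the edge of weight `dBot Adj w s t` lying on
a bottleneck-optimal simple path from `s` to `t`. -/
def IsBtlEdge (Adj : V → V → Prop) (w : V → V → ℝ) (s t : V) (e : V × V) : Prop :=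
  ∃ l, IsDiPath Adj s t l ∧ l.Nodup ∧ bottleneck w l = dBot Adj w s t ∧
    e ∈ l.zip l.tail ∧ w e.1 e.2 = dBot Adj w s t

/-- A path is retractable if either it has no edges, or it contains the bottleneck edge
`(u,v)` of its endpoints, and the subpath from its start to `u` and the subpath from `v`
to its end are both retractable. -/
inductive Retractable (Adj : V → V → Prop) (w : V → V → ℝ) : List V → Prop
  | single (v : V) : Retractable Adj w [v]
  | split (l₁ l₂ : List V) (u v s t : V)
      (h₁ : l₁.getLast? = some u) (h₂ : l₂.head? = some v)
      (hs : (l₁ ++ l₂).head? = some s) (ht : (l₁ ++ l₂).getLast? = some t)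
      (hbtl : IsBtlEdge Adj w s t (u, v))
      (r₁ : Retractable Adj w l₁) (r₂ : Retractable Adj w l₂) :
      Retractable Adj w (l₁ ++ l₂)

theorem mem_zip_tail_iff {l : List V} {u v : V} :
    (u, v) ∈ l.zip l.tail ↔ ∃ a b, l = a ++ u :: v :: b := by
  constructor
  · intro h
    induction l with
    | nil => simp at h
    | cons x l ih =>
      cases l with
      | nil => simp at h
      | cons y l =>
        simp only [List.tail_cons, List.zip_cons_cons, List.mem_cons, Prod.mk.injEq] at h
        rcases h with ⟨rfl, rfl⟩ | h
        · exact ⟨[], l, rfl⟩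
        · obtain ⟨a, b, hab⟩ := ih h
          exact ⟨x :: a, b, by rw [hab]; rfl⟩
  · rintro ⟨a, b, rfl⟩
    induction a with
    | nil => simp
    | cons x a ih => cases a <;> simp_all

/-- An edge of a concatenation lies in one of the two parts or joins them. -/
theorem mem_zip_tail_append {l₁ l₂ : List V} {e : V × V}
    (h : e ∈ (l₁ ++ l₂).zip (l₁ ++ l₂).tail) :
    e ∈ l₁.zip l₁.tail ∨ e ∈ l₂.zip l₂.tail ∨
      l₁.getLast? = some e.1 ∧ l₂.head? = some e.2 := by
  induction l₁ with
  | nil => exact Or.inr (Or.inl h)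
  | cons x l₁ ih =>
    cases l₁ with
    | nil =>
      cases l₂ with
      | nil => simp at h
      | cons y l₂ =>
        simp only [List.singleton_append, List.tail_cons, List.zip_cons_cons,
          List.mem_cons] at h
        rcases h with rfl | h
        · simp
        · exact Or.inr (Or.inl h)
    | cons y l₁ =>
      simp only [List.cons_append, List.tail_cons, List.zip_cons_cons, List.mem_cons] at h ih ⊢
      rcases h with rfl | h
      · exact Or.inl (Or.inl rfl)
      · rcases ih h with h | h | h
        · exact Or.inl (Or.inr h)
        · exact Or.inr (Or.inl h)
        · exact Or.inr (Or.inr (by simpa using h))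

theorem eq_singleton_of_head?_eq_getLast? {l : List V} {s : V} (hl : l.Nodup)
    (hs : l.head? = some s) (ht : l.getLast? = some s) : l = [s] := by
  obtain ⟨m, rfl⟩ := List.head?_eq_some_iff.1 hs
  cases m with
  | nil => rfl
  | cons y m =>
    rw [List.getLast?_cons_cons] at ht
    exact absurd (List.mem_of_getLast? ht) (List.nodup_cons.1 hl).1

theorem finite_edge_weights (w : V → V → ℝ) (l : List V) :
    ((fun e : V × V => w e.1 e.2) '' { e | e ∈ l.zip l.tail }).Finite :=
  (List.finite_toSet _).image _

theorem le_bottleneck (w : V → V → ℝ) {l : List V} {e : V × V} (he : e ∈ l.zip l.tail) :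
    w e.1 e.2 ≤ bottleneck w l :=
  le_csSup (finite_edge_weights w l).bddAbove ⟨e, he, rfl⟩

theorem bottleneck_le {w : V → V → ℝ} {l : List V} {r : ℝ} (hne : l.zip l.tail ≠ [])
    (h : ∀ e ∈ l.zip l.tail, w e.1 e.2 ≤ r) : bottleneck w l ≤ r := by
  obtain ⟨e, he⟩ := List.exists_mem_of_ne_nil _ hne
  refine csSup_le ⟨_, e, he, rfl⟩ ?_
  rintro _ ⟨e, he, rfl⟩
  exact h e he

theorem dBot_le_bottleneck [Finite V] {Adj : V → V → Prop} {w : V → V → ℝ} {s t : V}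
    {l : List V} (hl : IsDiPath Adj s t l) (hn : l.Nodup) :
    dBot Adj w s t ≤ bottleneck w l := by
  refine csInf_le ?_ ⟨l, hl, hn, rfl⟩
  refine (((Set.finite_range fun e : V × V => w e.1 e.2).insert 0).subset ?_).bddBelow
  rintro _ ⟨p, -, -, rfl⟩
  rcases Set.eq_empty_or_nonempty ((fun e : V × V => w e.1 e.2) '' { e | e ∈ p.zip p.tail })
    with h | h
  · left
    rw [bottleneck, h, Real.sSup_empty]
  · right
    exact Set.image_subset_range _ _ (h.csSup_mem (finite_edge_weights w p))

/-- A nontrivial simple subpath of a simple path bounds the bottleneck distance of its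
endpoints by the bottleneck of the whole path. -/
theorem dBot_le_bottleneck_of_infix [Finite V] {Adj : V → V → Prop} {w : V → V → ℝ} {s t : V}
    {p q : List V} (hpq : p <:+: q) (hc : q.IsChain Adj) (hn : q.Nodup)
    (hs : p.head? = some s) (ht : p.getLast? = some t) (hst : s ≠ t) :
    dBot Adj w s t ≤ bottleneck w q := by
  refine (dBot_le_bottleneck ⟨hs, ht, hc.infix hpq⟩ (hn.sublist hpq.sublist)).trans ?_
  refine bottleneck_le ?_ ?_
  · obtain ⟨m, rfl⟩ := List.head?_eq_some_iff.1 hs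
    cases m with
    | nil => simp_all
    | cons y m => simp
  · rintro ⟨a, b⟩ he
    refine le_bottleneck w (e := (a, b)) ?_
    obtain ⟨x, y, rfl⟩ := hpq
    obtain ⟨c, d, rfl⟩ := mem_zip_tail_iff.1 he
    exact mem_zip_tail_iff.2 ⟨x ++ c, d ++ y, by simp⟩

theorem Retractable.weight_le_dBot [Finite V] {Adj : V → V → Prop} {w : V → V → ℝ}
    {l : List V} (h : Retractable Adj w l) (hn : l.Nodup) {s t : V} (hs : l.head? = some s)
    (ht : l.getLast? = some t) {e : V × V} (he : e ∈ l.zip l.tail) :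
    w e.1 e.2 ≤ dBot Adj w s t := by
  induction h generalizing s t with
  | single v => simp at he
  | split l₁ l₂ u v s' t' h₁ h₂ hs' ht' hbtl r₁ r₂ ih₁ ih₂ =>
    obtain rfl : s' = s := Option.some.inj (hs'.symm.trans hs)
    obtain rfl : t' = t := Option.some.inj (ht'.symm.trans ht)
    obtain ⟨p, ⟨hps, hpt, hpc⟩, hpn, hpb, hep, hew⟩ := hbtl
    obtain ⟨a, b, rfl⟩ := mem_zip_tail_iff.1 hep
    have hn₁ := hn.sublist (List.sublist_append_left l₁ l₂)
    have hn₂ := hn.sublist (List.sublist_append_right l₁ l₂)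
    have hs₁ : l₁.head? = some s' := by
      cases l₁ <;> simp_all
    have ht₂ : l₂.getLast? = some t' := by
      rw [List.getLast?_append] at ht
      cases hl : l₂.getLast? <;> simp_all
    rcases mem_zip_tail_append he with he | he | ⟨h₁', h₂'⟩
    · have hsu : s' ≠ u := by
        rintro rfl
        rw [eq_singleton_of_head?_eq_getLast? hn₁ hs₁ h₁] at he
        simp at he
      refine (ih₁ hn₁ hs₁ h₁ he).trans (hpb ▸ ?_)
      refine dBot_le_bottleneck_of_infix (p := a ++ [u]) ⟨[], v :: b, by simp⟩ hpc hpn ?_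
        (by simp) hsu
      cases a <;> simp_all
    · have hvt : v ≠ t' := by
        rintro rfl
        rw [eq_singleton_of_head?_eq_getLast? hn₂ h₂ ht₂] at he
        simp at he
      refine (ih₂ hn₂ h₂ ht₂ he).trans (hpb ▸ ?_)
      refine dBot_le_bottleneck_of_infix (p := v :: b) ⟨a ++ [u], [], by simp⟩ hpc hpn
        (by simp) ?_ hvt
      simpa [List.getLast?_append, List.getLast?_cons_cons] using hpt
    · obtain rfl : u = e.1 := Option.some.inj (h₁.symm.trans h₁')
      obtain rfl : v = e.2 := Option.some.inj (h₂.symm.trans h₂')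
      exact hew.le

/-- In a finite directed graph with pairwise distinct edge weights, every
retractable simple directed path from `s` to `t` realizes the bottleneck distance from `s`
to `t`. -/
theorem retractable_path_realizes_bottleneck [Fintype V]
    (Adj : V → V → Prop) (w : V → V → ℝ)
    (hw : ∀ a b a' b', Adj a b → Adj a' b' → w a b = w a' b' → (a, b) = (a', b'))
    (s t : V) (hconn : ∃ l, IsDiPath Adj s t l) :
    ∀ l : List V, IsDiPath Adj s t l → l.Nodup → Retractable Adj w l →
      bottleneck w l = dBot Adj w s t := by
  intro l hl hn hr
  refine le_antisymm ?_ (dBot_le_bottleneck hl hn)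
  by_cases hne : l.zip l.tail = []
  · refine le_csInf ⟨_, l, hl, hn, rfl⟩ ?_
    have hl' : l = [s] := by
      obtain ⟨m, rfl⟩ := List.head?_eq_some_iff.1 hl.1
      cases m <;> simp_all
    subst hl'
    obtain rfl : s = t := by simpa using hl.2.1
    rintro _ ⟨p, hp, hpn, rfl⟩
    rw [eq_singleton_of_head?_eq_getLast? hpn hp.1 hp.2.1]
  · exact bottleneck_le hne fun e he => hr.weight_le_dBot hn hl.1 hl.2.1 he
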